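/- Let 0 < α < β < 1. Then (m × m){(x,ω) ∈ Δ₀ : R(x,ω) > n} is asymptotically equivalent, as n → ∞, to (1/4)(α p₁)^{-1/α} n^{-1/α}; that is, the ratio of the two quantities tends to 1. -/

import Mathlib

open MeasureTheory Filter Set Topology

noncomputable section

/-- The Liverani–Saussol–Vaienti map `T_a` on `[0,1]`. -/
def lsv (a x : ℝ) : ℝ := if x ≤ 1 / 2 then x * (1 + (2 : ℝ) ^ a * x ^ a) else 2 * x - 1

/-- Random parameter selection: `α` on `[0,p₁)`, `β` on `[p₁,1]`. -/
def alphaOf (α β p₁ ω : ℝ) : ℝ := if ω < p₁ then α else β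

/-- The noise dynamics `φ` on `[0,1]`. -/
def phiMap (p₁ ω : ℝ) : ℝ := if ω < p₁ then ω / p₁ else (ω - p₁) / (1 - p₁)

/-- The skew product `S(x,ω) = (T_{α(ω)} x, φ ω)`. -/
def skewLSV (α β p₁ : ℝ) (p : ℝ × ℝ) : ℝ × ℝ :=
  (lsv (alphaOf α β p₁ p.2) p.1, phiMap p₁ p.2)

/-- The base of inducing, `Δ₀ = (1/2,1] × [0,1]`. -/
def Δ0 : Set (ℝ × ℝ) := Ioc (1 / 2 : ℝ) 1 ×ˢ Icc (0 : ℝ) 1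

/-- First return time of the skew product `S` to `Δ₀`. -/
def retTime (α β p₁ : ℝ) (p : ℝ × ℝ) : ℕ :=
  sInf {n : ℕ | 1 ≤ n ∧ (skewLSV α β p₁)^[n] p ∈ Δ0}

/-- The number of the first `n` points of the `φ`-orbit of `ω` that lie in `[0,p₁)`. -/
def alphaCount (p₁ : ℝ) : ℕ → ℝ → ℝ
  | 0, _ => 0
  | n + 1, ω => (if ω < p₁ then 1 else 0) + alphaCount p₁ n (phiMap p₁ ω)

section PowerEstimates

lemma one_add_rpow_neg_le {a t : ℝ} (ha : 0 ≤ a) (ha1 : a ≤ 1) (ht : 0 ≤ t) :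
    (1 + t) ^ (-a) ≤ 1 - a * (t / (1 + t)) := by
  have h1 : (0 : ℝ) < 1 + t := by linarith
  have h2 : (1 + t)⁻¹ = 1 + -(t / (1 + t)) := by field_simp; ring
  have h3 : t / (1 + t) ≤ 1 := by rw [div_le_one h1]; linarith
  rw [Real.rpow_neg h1.le, ← Real.inv_rpow h1.le, h2]
  have := rpow_one_add_le_one_add_mul_self (s := -(t / (1 + t))) (p := a) (by linarith) ha ha1
  linarith

lemma one_sub_mul_le_one_add_rpow_neg {a t : ℝ} (ha : 0 ≤ a) (ha1 : a ≤ 1) (ht : 0 ≤ t) :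
    1 - a * t ≤ (1 + t) ^ (-a) := by
  have h1 : (0 : ℝ) < 1 + t := by linarith
  have h2 := rpow_one_add_le_one_add_mul_self (s := t) (p := a) (by linarith) ha ha1
  have h3 : 0 < (1 + t) ^ a := Real.rpow_pos_of_pos h1 a
  have h4 : 0 ≤ a * t := mul_nonneg ha ht
  rw [Real.rpow_neg h1.le, ← one_div, le_div_iff₀ h3]
  nlinarith [mul_nonneg h4 h3.le, mul_nonneg h4 (sub_nonneg.2 h2)]

lemma rpow_neg_sub_rpow_neg (a b : ℝ) {v : ℝ} (hv : 0 < v) :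
    v ^ (-a) - (v * (1 + v ^ b)) ^ (-a) = v ^ (-a) * (1 - (1 + v ^ b) ^ (-a)) := by
  have : 0 ≤ 1 + v ^ b := by positivity
  rw [Real.mul_rpow hv.le this]; ring

/-- One step of the map, seen through `v ↦ v ^ (-a)`: the increment is at least `a / 2`. -/
lemma half_le_rpow_neg_sub {a b v : ℝ} (ha : 0 ≤ a) (ha1 : a ≤ 1) (hba : b ≤ a) (hb : 0 ≤ b)
    (hv : 0 < v) (hv1 : v ≤ 1) : a / 2 ≤ v ^ (-a) - (v * (1 + v ^ b)) ^ (-a) := by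
  rw [rpow_neg_sub_rpow_neg a b hv]
  have hp : 0 < v ^ b := Real.rpow_pos_of_pos hv b
  have hp1 : v ^ b ≤ 1 := Real.rpow_le_one hv.le hv1 hb
  have h1 := one_add_rpow_neg_le ha ha1 hp.le
  have h2 : v ^ a ≤ v ^ b := Real.rpow_le_rpow_of_exponent_ge hv hv1 hba
  have h3 : v ^ b / 2 ≤ v ^ b / (1 + v ^ b) := by gcongr; linarith
  have hq : 0 < v ^ (-a) := Real.rpow_pos_of_pos hv _
  have h4 : v ^ (-a) * v ^ a = 1 := by rw [← Real.rpow_add hv]; simp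
  have h5 : 1 ≤ v ^ (-a) * v ^ b := by rw [← h4]; gcongr
  calc a / 2 ≤ a / 2 * (v ^ (-a) * v ^ b) := le_mul_of_one_le_right (by linarith) h5
    _ = v ^ (-a) * (a * (v ^ b / 2)) := by ring
    _ ≤ v ^ (-a) * (1 - (1 + v ^ b) ^ (-a)) := by
        apply mul_le_mul_of_nonneg_left _ hq.le
        have := mul_le_mul_of_nonneg_left h3 ha
        linarith

lemma rpow_neg_sub_nonneg {a : ℝ} (b : ℝ) {v : ℝ} (ha : 0 ≤ a) (hv : 0 < v) :
    0 ≤ v ^ (-a) - (v * (1 + v ^ b)) ^ (-a) := by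
  have hp : 0 < v ^ b := Real.rpow_pos_of_pos hv b
  rw [sub_nonneg]
  exact Real.rpow_le_rpow_of_nonpos hv (by nlinarith) (by linarith)

lemma rpow_neg_sub_le {a : ℝ} (b : ℝ) {v : ℝ} (ha : 0 ≤ a) (ha1 : a ≤ 1) (hv : 0 < v) :
    v ^ (-a) - (v * (1 + v ^ b)) ^ (-a) ≤ a * v ^ (b - a) := by
  rw [rpow_neg_sub_rpow_neg a b hv]
  have hp : 0 < v ^ b := Real.rpow_pos_of_pos hv b
  have h1 := one_sub_mul_le_one_add_rpow_neg ha ha1 hp.le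
  calc v ^ (-a) * (1 - (1 + v ^ b) ^ (-a)) ≤ v ^ (-a) * (a * v ^ b) := by gcongr; linarith
    _ = a * v ^ (b - a) := by rw [sub_eq_add_neg, Real.rpow_add hv]; ring

lemma sub_mul_le_rpow_neg_sub {a v : ℝ} (ha : 0 ≤ a) (ha1 : a ≤ 1) (hv : 0 < v) :
    a - a * v ^ a ≤ v ^ (-a) - (v * (1 + v ^ a)) ^ (-a) := by
  rw [rpow_neg_sub_rpow_neg a a hv]
  have hp : 0 < v ^ a := Real.rpow_pos_of_pos hv a
  have h1 := one_add_rpow_neg_le ha ha1 hp.le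
  have h4 : v ^ (-a) * v ^ a = 1 := by rw [← Real.rpow_add hv]; simp
  have h5 : 1 - v ^ a ≤ 1 / (1 + v ^ a) := by
    rw [le_div_iff₀ (by linarith)]; nlinarith
  calc a - a * v ^ a = a * (1 - v ^ a) := by ring
    _ ≤ a * (1 / (1 + v ^ a)) := by gcongr
    _ = v ^ (-a) * (a * (v ^ a / (1 + v ^ a))) := by
        rw [← h4]; ring
    _ ≤ v ^ (-a) * (1 - (1 + v ^ a) ^ (-a)) := by gcongr; linarith

end PowerEstimates

section Orbits

variable {α β p₁ : ℝ}

lemma two_mul_lsv (a : ℝ) {x : ℝ} (hx : 0 < x) (hx' : x ≤ 1 / 2) :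
    2 * lsv a x = 2 * x * (1 + (2 * x) ^ a) := by
  rw [lsv, if_pos hx', Real.mul_rpow (by norm_num) hx.le]; ring

lemma lsv_mem_Ioc {a x : ℝ} (ha : 0 ≤ a) (hx : x ∈ Ioc (0 : ℝ) 1) : lsv a x ∈ Ioc (0 : ℝ) 1 := by
  obtain ⟨h0, h1⟩ := hx
  by_cases h : x ≤ 1 / 2
  · have h2 := two_mul_lsv a h0 h
    have h3 : (2 * x) ^ a ≤ 1 := Real.rpow_le_one (by linarith) (by linarith) ha
    have h4 : 0 < (2 * x) ^ a := Real.rpow_pos_of_pos (by linarith) a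
    constructor <;> nlinarith
  · rw [lsv, if_neg h]; constructor <;> linarith

lemma alphaOf_nonneg (hα : 0 ≤ α) (hβ : 0 ≤ β) (ω : ℝ) : 0 ≤ alphaOf α β p₁ ω := by
  unfold alphaOf; split_ifs <;> assumption

lemma alphaOf_le (hαβ : α ≤ β) (ω : ℝ) : alphaOf α β p₁ ω ≤ β := by
  unfold alphaOf; split_ifs <;> simp [hαβ]

lemma phiMap_mem_Icc (hp₁ : 0 < p₁) (hp₁' : p₁ < 1) {ω : ℝ} (hω : ω ∈ Icc (0 : ℝ) 1) :
    phiMap p₁ ω ∈ Icc (0 : ℝ) 1 := by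
  obtain ⟨h0, h1⟩ := hω
  have : 0 < 1 - p₁ := by linarith
  unfold phiMap; split_ifs with h
  · exact ⟨by positivity, by rw [div_le_one hp₁]; linarith⟩
  · push Not at h
    exact ⟨div_nonneg (by linarith) this.le, by rw [div_le_one this]; linarith⟩

lemma skewLSV_iterate_mem (hα : 0 ≤ α) (hβ : 0 ≤ β) (hp₁ : 0 < p₁) (hp₁' : p₁ < 1)
    {q : ℝ × ℝ} (hq : q ∈ Ioc (0 : ℝ) 1 ×ˢ Icc (0 : ℝ) 1) (n : ℕ) :
    (skewLSV α β p₁)^[n] q ∈ Ioc (0 : ℝ) 1 ×ˢ Icc (0 : ℝ) 1 := by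
  induction n generalizing q with
  | zero => exact hq
  | succ n ih =>
    exact ih ⟨lsv_mem_Ioc (alphaOf_nonneg hα hβ _) hq.1, phiMap_mem_Icc hp₁ hp₁' hq.2⟩

lemma mul_le_rpow_neg_of_iterate_le (hα : 0 ≤ α) (hαβ : α ≤ β) (hβ : β ≤ 1) (m : ℕ) :
    ∀ q : ℝ × ℝ, 0 < q.1 → (∀ j < m, ((skewLSV α β p₁)^[j] q).1 ≤ 1 / 2) →
      β / 2 * m ≤ (2 * q.1) ^ (-β) := by
  induction m with
  | zero => intro q hq _; simp; positivity
  | succ m ih =>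
    intro q hq h
    have h0 : q.1 ≤ 1 / 2 := h 0 (Nat.succ_pos m)
    have hs : 2 * (skewLSV α β p₁ q).1 = 2 * q.1 * (1 + (2 * q.1) ^ alphaOf α β p₁ q.2) :=
      two_mul_lsv _ hq h0
    have hpos : 0 < (2 * q.1) ^ alphaOf α β p₁ q.2 := Real.rpow_pos_of_pos (by linarith) _
    have h1 := ih (skewLSV α β p₁ q) (by nlinarith) fun j hj => h (j + 1) (by omega)
    have h2 := half_le_rpow_neg_sub (hα.trans hαβ) hβ (alphaOf_le (p₁ := p₁) hαβ q.2)
      (alphaOf_nonneg hα (hα.trans hαβ) q.2) (v := 2 * q.1) (by linarith) (by linarith)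
    rw [hs] at h1
    push_cast
    linarith

/-- A bound for the deviation of one step from a pure translation when `k + 1` steps remain. -/
def stepError (α β : ℝ) (k : ℕ) : ℝ := (β / 2 * (k + 1 : ℕ)) ^ (-(min α (β - α) / β))

lemma stepError_nonneg (hβ : 0 ≤ β) (k : ℕ) : 0 ≤ stepError α β k := by
  unfold stepError; positivity

lemma abs_step_sub_le (hα : 0 < α) (hαβ : α < β) (hβ : β ≤ 1) {v : ℝ} (ω : ℝ)
    (hv : 0 < v) (hv1 : v ≤ 1) :
    |v ^ (-α) - (v * (1 + v ^ alphaOf α β p₁ ω)) ^ (-α) - α * (if ω < p₁ then 1 else 0)| ≤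
      α * v ^ min α (β - α) := by
  unfold alphaOf
  split_ifs with h
  · have h1 := sub_mul_le_rpow_neg_sub hα.le (by linarith) hv
    have h2 := rpow_neg_sub_le α hα.le (by linarith) hv
    have h3 : v ^ α ≤ v ^ min α (β - α) :=
      Real.rpow_le_rpow_of_exponent_ge hv hv1 (min_le_left _ _)
    have h4 := mul_le_mul_of_nonneg_left h3 hα.le
    have h5 : 0 ≤ α * v ^ α := by positivity
    simp only [sub_self, Real.rpow_zero] at h2
    rw [abs_le]; constructor <;> linarith
  · have h1 := rpow_neg_sub_nonneg β hα.le hv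
    have h2 := rpow_neg_sub_le β hα.le (by linarith) hv
    have h3 : v ^ (β - α) ≤ v ^ min α (β - α) :=
      Real.rpow_le_rpow_of_exponent_ge hv hv1 (min_le_right _ _)
    have h4 := mul_le_mul_of_nonneg_left h3 hα.le
    rw [abs_le]; constructor <;> linarith

/-- As long as an orbit stays in the left half, `(2x)^(-α)` decreases by `α` for each use of
`T_α`, up to an error that does not depend on the noise. -/
lemma abs_rpow_neg_sub_alphaCount_le (hα : 0 < α) (hαβ : α < β) (hβ : β ≤ 1) (m : ℕ) :
    ∀ q : ℝ × ℝ, 0 < q.1 → (∀ j < m, ((skewLSV α β p₁)^[j] q).1 ≤ 1 / 2) →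
      |(2 * q.1) ^ (-α) - (2 * ((skewLSV α β p₁)^[m] q).1) ^ (-α) - α * alphaCount p₁ m q.2| ≤
        α * ∑ i ∈ Finset.range m, stepError α β i := by
  induction m with
  | zero => intro q _ _; simp [alphaCount]
  | succ m ih =>
    intro q hq h
    have h0 : q.1 ≤ 1 / 2 := h 0 (Nat.succ_pos m)
    have hs : 2 * (skewLSV α β p₁ q).1 = 2 * q.1 * (1 + (2 * q.1) ^ alphaOf α β p₁ q.2) :=
      two_mul_lsv _ hq h0
    have hpos : 0 < (2 * q.1) ^ alphaOf α β p₁ q.2 := Real.rpow_pos_of_pos (by linarith) _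
    have h1 := ih (skewLSV α β p₁ q) (by nlinarith) fun j hj => h (j + 1) (by omega)
    have hv : 0 < 2 * q.1 := by linarith
    have h2 := abs_step_sub_le (p₁ := p₁) hα hαβ hβ q.2 hv (by linarith)
    have hβ0 : 0 < β := hα.trans hαβ
    have h3 : (2 * q.1) ^ min α (β - α) ≤ stepError α β m := by
      have h4 := mul_le_rpow_neg_of_iterate_le hα.le hαβ.le hβ (m + 1) q hq h
      have h5 : 0 ≤ min α (β - α) := le_min hα.le (by linarith)
      have h6 := Real.rpow_le_rpow_of_nonpos (by positivity) h4
        (z := -(min α (β - α) / β)) (by simp; positivity)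
      rw [← Real.rpow_mul hv.le] at h6
      have h7 : -β * -(min α (β - α) / β) = min α (β - α) := by field_simp
      rwa [h7] at h6
    have h4 := mul_le_mul_of_nonneg_left h3 hα.le
    rw [hs] at h1
    rw [Finset.sum_range_succ, alphaCount, Function.iterate_succ_apply]
    have h6 : (skewLSV α β p₁ q).2 = phiMap p₁ q.2 := rfl
    rw [h6] at h1
    rw [abs_le] at *
    constructor <;> linarith [h1.1, h1.2, h2.1, h2.2]

end Orbits

section Counting

variable {p₁ : ℝ}

lemma measurable_phiMap (p₁ : ℝ) : Measurable (phiMap p₁) :=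
  Measurable.ite measurableSet_Iio (by fun_prop) (by fun_prop)

lemma measurable_alphaCount (p₁ : ℝ) (n : ℕ) : Measurable (alphaCount p₁ n) := by
  induction n with
  | zero => exact measurable_const
  | succ n ih =>
    exact (Measurable.ite measurableSet_Iio measurable_const measurable_const).add
      (ih.comp (measurable_phiMap p₁))

lemma alphaCount_mem_Icc (n : ℕ) : ∀ ω, alphaCount p₁ n ω ∈ Icc (0 : ℝ) n := by
  induction n with
  | zero => intro ω; simp [alphaCount]
  | succ n ih =>
    intro ω
    have h := ih (phiMap p₁ ω)
    rw [alphaCount, mem_Icc]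
    push_cast
    split_ifs <;> constructor <;> linarith [h.1, h.2]

lemma alphaCount_mono {m n : ℕ} (h : m ≤ n) : ∀ ω, alphaCount p₁ m ω ≤ alphaCount p₁ n ω := by
  induction m generalizing n with
  | zero => intro ω; exact (alphaCount_mem_Icc n ω).1
  | succ m ih =>
    obtain _ | n := n
    · omega
    intro ω
    have := ih (Nat.le_of_succ_le_succ h) (phiMap p₁ ω)
    rw [alphaCount, alphaCount]
    linarith

lemma integrable_exp_mul_alphaCount {μ : Measure ℝ} [IsFiniteMeasure μ] (t : ℝ) (n : ℕ) :
    Integrable (fun ω => Real.exp (t * alphaCount p₁ n ω)) μ := by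
  refine Integrable.of_bound
    ((measurable_alphaCount p₁ n).const_mul t).exp.aestronglyMeasurable (Real.exp (|t| * n))
    (Eventually.of_forall fun ω => ?_)
  have h := alphaCount_mem_Icc (p₁ := p₁) n ω
  rw [Real.norm_eq_abs, Real.abs_exp]
  gcongr
  · exact h.1
  · exact le_abs_self t
  · exact h.2

lemma integral_exp_mul_alphaCount (hp₁ : 0 < p₁) (hp₁' : p₁ < 1) (t : ℝ) (n : ℕ) :
    ∫ ω in (0 : ℝ)..1, Real.exp (t * alphaCount p₁ n ω) = (p₁ * Real.exp t + (1 - p₁)) ^ n := by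
  induction n with
  | zero => simp [alphaCount]
  | succ n ih =>
    have hq : 0 < 1 - p₁ := by linarith
    have hint : ∀ a b : ℝ, IntervalIntegrable
        (fun ω => Real.exp (t * alphaCount p₁ (n + 1) ω)) volume a b := fun a b =>
      ⟨integrable_exp_mul_alphaCount t _, integrable_exp_mul_alphaCount t _⟩
    rw [← intervalIntegral.integral_add_adjacent_intervals (hint 0 p₁) (hint p₁ 1)]
    have h1 : ∫ ω in (0 : ℝ)..p₁, Real.exp (t * alphaCount p₁ (n + 1) ω) =
        ∫ ω in (0 : ℝ)..p₁, Real.exp t * Real.exp (t * alphaCount p₁ n (ω / p₁)) := by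
      apply intervalIntegral.integral_congr_ae
      filter_upwards [compl_mem_ae_iff.2 (measure_singleton (μ := volume) p₁)] with ω hne hω
      rw [uIoc_of_le hp₁.le] at hω
      have hlt : ω < p₁ := lt_of_le_of_ne hω.2 hne
      rw [alphaCount, phiMap, if_pos hlt, if_pos hlt, mul_add, mul_one, Real.exp_add]
    have h2 : ∫ ω in p₁..1, Real.exp (t * alphaCount p₁ (n + 1) ω) =
        ∫ ω in p₁..1, Real.exp (t * alphaCount p₁ n (ω / (1 - p₁) - p₁ / (1 - p₁))) := by
      apply intervalIntegral.integral_congr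
      intro ω hω
      rw [uIcc_of_le hp₁'.le] at hω
      have hlt : ¬ ω < p₁ := not_lt.2 hω.1
      simp only [alphaCount, phiMap, if_neg hlt, zero_add, sub_div]
    have h3 : 1 / (1 - p₁) - p₁ / (1 - p₁) = 1 := by field_simp
    rw [h1, h2, intervalIntegral.integral_const_mul,
      intervalIntegral.integral_comp_div (fun x => Real.exp (t * alphaCount p₁ n x)) hp₁.ne',
      intervalIntegral.integral_comp_div_sub (fun x => Real.exp (t * alphaCount p₁ n x)) hq.ne',
      zero_div, div_self hp₁.ne', sub_self, h3, ih, smul_eq_mul, smul_eq_mul]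
    ring

lemma mgf_alphaCount (hp₁ : 0 < p₁) (hp₁' : p₁ < 1) (t : ℝ) (n : ℕ) :
    ProbabilityTheory.mgf (alphaCount p₁ n) (volume.restrict (Icc (0 : ℝ) 1)) t =
      (p₁ * Real.exp t + (1 - p₁)) ^ n := by
  rw [← integral_exp_mul_alphaCount hp₁ hp₁', intervalIntegral.integral_of_le zero_le_one,
    ← integral_Icc_eq_integral_Ioc, ProbabilityTheory.mgf]

lemma bernoulli_mgf_le {p t : ℝ} (hp : 0 ≤ p) (hp' : p ≤ 1) (ht : |t| ≤ 1) :
    p * Real.exp t + (1 - p) ≤ Real.exp (t * p + t ^ 2) := by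
  have key : ∀ s : ℝ, |s| ≤ |t| → Real.exp s ≤ 1 + s + t ^ 2 := fun s hs => by
    have h1 := (abs_le.1 (Real.abs_exp_sub_one_sub_id_le (hs.trans ht))).2
    have h2 := sq_le_sq.2 hs
    linarith
  have h1 : |t * (1 - p)| ≤ |t| := by
    rw [abs_mul]
    exact mul_le_of_le_one_right (abs_nonneg t) (by rw [abs_le]; constructor <;> linarith)
  have h2 : |-(t * p)| ≤ |t| := by
    rw [abs_neg, abs_mul]
    exact mul_le_of_le_one_right (abs_nonneg t) (by rw [abs_le]; constructor <;> linarith)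
  have e1 : Real.exp t = Real.exp (t * p) * Real.exp (t * (1 - p)) := by
    rw [← Real.exp_add]; ring_nf
  have e2 : Real.exp (t * p) * Real.exp (-(t * p)) = 1 := by rw [← Real.exp_add]; simp
  calc p * Real.exp t + (1 - p)
      = Real.exp (t * p) *
          (p * Real.exp (t * (1 - p)) + (1 - p) * Real.exp (-(t * p))) := by
        rw [e1]; linear_combination (p - 1) * e2
    _ ≤ Real.exp (t * p) * Real.exp (t ^ 2) := by
        gcongr
        have h3 := mul_le_mul_of_nonneg_left (key _ h1) hp
        have h4 := mul_le_mul_of_nonneg_left (key _ h2) (sub_nonneg.2 hp')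
        have h5 := Real.add_one_le_exp (t ^ 2)
        nlinarith
    _ = Real.exp (t * p + t ^ 2) := (Real.exp_add _ _).symm

lemma chernoff_bound_le {p ε t : ℝ} (hp : 0 ≤ p) (hp' : p ≤ 1) (ht : |t| ≤ 1) (n : ℕ)
    (hε : t * ε = 2 * t ^ 2) :
    Real.exp (-t * ((p + ε) * n)) * (p * Real.exp t + (1 - p)) ^ n ≤ Real.exp (-(t ^ 2) * n) := by
  have h1 : (p * Real.exp t + (1 - p)) ^ n ≤ Real.exp (t * p + t ^ 2) ^ n := by
    apply pow_le_pow_left₀ _ (bernoulli_mgf_le hp hp' ht)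
    have := Real.exp_pos t
    nlinarith
  refine (mul_le_mul_of_nonneg_left h1 (Real.exp_pos _).le).trans (le_of_eq ?_)
  rw [← Real.exp_nat_mul, ← Real.exp_add]
  congr 1
  linear_combination (-(n : ℝ)) * hε

lemma measureReal_le_alphaCount (hp₁ : 0 < p₁) (hp₁' : p₁ < 1) {ε : ℝ} (hε : 0 ≤ ε)
    (hε' : ε ≤ 2) (n : ℕ) :
    (volume.restrict (Icc (0 : ℝ) 1)).real {ω | (p₁ + ε) * n ≤ alphaCount p₁ n ω} ≤
      Real.exp (-((ε / 2) ^ 2) * n) := by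
  refine (ProbabilityTheory.measure_ge_le_exp_mul_mgf (t := ε / 2) _ (by positivity)
    (integrable_exp_mul_alphaCount _ n)).trans ?_
  rw [mgf_alphaCount hp₁ hp₁']
  exact chernoff_bound_le hp₁.le hp₁'.le (by rw [abs_le]; constructor <;> linarith) n (by ring)

lemma measureReal_alphaCount_le (hp₁ : 0 < p₁) (hp₁' : p₁ < 1) {ε : ℝ} (hε : 0 ≤ ε)
    (hε' : ε ≤ 2) (n : ℕ) :
    (volume.restrict (Icc (0 : ℝ) 1)).real {ω | alphaCount p₁ n ω ≤ (p₁ - ε) * n} ≤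
      Real.exp (-((ε / 2) ^ 2) * n) := by
  refine (ProbabilityTheory.measure_le_le_exp_mul_mgf (t := -(ε / 2)) _ (by linarith)
    (integrable_exp_mul_alphaCount _ n)).trans ?_
  rw [mgf_alphaCount hp₁ hp₁', sub_eq_add_neg, ← neg_sq (ε / 2)]
  exact chernoff_bound_le hp₁.le hp₁'.le (by rw [abs_le]; constructor <;> linarith) n (by ring)

end Counting

section ReturnTime

variable {α β p₁ : ℝ}

/-- The error term in the comparison of the return time with the count of uses of `T_α`. -/
def slack (α β : ℝ) (n : ℕ) : ℝ := 1 + α + α * ∑ i ∈ Finset.range n, stepError α β i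

lemma skewLSV_of_mem {p : ℝ × ℝ} (hp : p ∈ Δ0) :
    skewLSV α β p₁ p = (2 * p.1 - 1, phiMap p₁ p.2) := by
  have : ¬ p.1 ≤ 1 / 2 := not_le.2 hp.1.1
  simp only [skewLSV, lsv, if_neg this]

lemma iterate_skewLSV_mem_of_mem (hα : 0 ≤ α) (hβ : 0 ≤ β) (hp₁ : 0 < p₁) (hp₁' : p₁ < 1)
    {p : ℝ × ℝ} (hp : p ∈ Δ0) (k : ℕ) :
    (skewLSV α β p₁)^[k + 1] p ∈ Ioc (0 : ℝ) 1 ×ˢ Icc (0 : ℝ) 1 := by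
  apply skewLSV_iterate_mem hα hβ hp₁ hp₁'
  obtain ⟨⟨h1, h2⟩, h3⟩ := hp
  exact ⟨⟨by linarith, h2⟩, h3⟩

lemma iterate_fst_le_half_of_notMem (hα : 0 ≤ α) (hβ : 0 ≤ β) (hp₁ : 0 < p₁) (hp₁' : p₁ < 1)
    {p : ℝ × ℝ} (hp : p ∈ Δ0) {k : ℕ} (hk : (skewLSV α β p₁)^[k + 1] p ∉ Δ0) :
    ((skewLSV α β p₁)^[k] (2 * p.1 - 1, phiMap p₁ p.2)).1 ≤ 1 / 2 := by
  rw [← skewLSV_of_mem hp, ← Function.iterate_succ_apply]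
  by_contra! h
  have := iterate_skewLSV_mem_of_mem hα hβ hp₁ hp₁' hp k
  exact hk ⟨⟨h, this.1.2⟩, this.2⟩

lemma exists_iterate_mem (hα : 0 < α) (hαβ : α < β) (hβ : β ≤ 1) (hp₁ : 0 < p₁) (hp₁' : p₁ < 1)
    {p : ℝ × ℝ} (hp : p ∈ Δ0) : {n : ℕ | 1 ≤ n ∧ (skewLSV α β p₁)^[n] p ∈ Δ0}.Nonempty := by
  by_contra! h
  have hβ0 : 0 < β := hα.trans hαβ
  have hall : ∀ k, ((skewLSV α β p₁)^[k] (2 * p.1 - 1, phiMap p₁ p.2)).1 ≤ 1 / 2 := fun k =>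
    iterate_fst_le_half_of_notMem hα.le hβ0.le hp₁ hp₁' hp fun hk =>
      (eq_empty_iff_forall_notMem.1 h (k + 1)) ⟨by omega, hk⟩
  obtain ⟨m, hm⟩ := exists_nat_gt ((2 * (2 * p.1 - 1)) ^ (-β) / (β / 2))
  rw [div_lt_iff₀ (by positivity)] at hm
  have := mul_le_rpow_neg_of_iterate_le hα.le hαβ.le hβ m (2 * p.1 - 1, phiMap p₁ p.2)
    (by have := hp.1.1; simp only; linarith) fun j _ => hall j
  simp only at this
  linarith

lemma le_of_lt_retTime (hα : 0 < α) (hαβ : α < β) (hβ : β ≤ 1) (hp₁ : 0 < p₁) (hp₁' : p₁ < 1)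
    {p : ℝ × ℝ} (hp : p ∈ Δ0) {n : ℕ} (hn : 1 ≤ n) (h : n < retTime α β p₁ p) :
    α * alphaCount p₁ n p.2 - slack α β n ≤ (2 * (2 * p.1 - 1)) ^ (-α) := by
  have hβ0 : 0 < β := hα.trans hαβ
  obtain ⟨m, rfl⟩ : ∃ m, n = m + 1 := ⟨n - 1, by omega⟩
  have hpos : 0 < 2 * p.1 - 1 := by have := hp.1.1; linarith
  have hall : ∀ k ≤ m, ((skewLSV α β p₁)^[k] (2 * p.1 - 1, phiMap p₁ p.2)).1 ≤ 1 / 2 :=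
    fun k hk => iterate_fst_le_half_of_notMem hα.le hβ0.le hp₁ hp₁' hp fun hk' =>
      Nat.notMem_of_lt_sInf (lt_of_le_of_lt (Nat.succ_le_succ hk) h) ⟨by omega, hk'⟩
  have h1 := (abs_le.1 (abs_rpow_neg_sub_alphaCount_le hα hαβ hβ m
    (2 * p.1 - 1, phiMap p₁ p.2) hpos fun j hj => hall j hj.le)).1
  have h2 := (iterate_skewLSV_mem_of_mem hα.le hβ0.le hp₁ hp₁' hp m).1.1
  rw [Function.iterate_succ_apply, skewLSV_of_mem hp] at h2
  have h3 : 0 < (2 * ((skewLSV α β p₁)^[m] (2 * p.1 - 1, phiMap p₁ p.2)).1) ^ (-α) :=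
    Real.rpow_pos_of_pos (by linarith) _
  have h4 := mul_nonneg hα.le (stepError_nonneg (α := α) hβ0.le m)
  have h5 : (if p.2 < p₁ then 1 else 0 : ℝ) ≤ 1 := by split_ifs <;> norm_num
  have h6 := mul_le_mul_of_nonneg_left h5 hα.le
  rw [slack, Finset.sum_range_succ, alphaCount]
  simp only at h1
  linarith

lemma lt_retTime_of_lt (hα : 0 < α) (hαβ : α < β) (hβ : β ≤ 1) (hp₁ : 0 < p₁) (hp₁' : p₁ < 1)
    {p : ℝ × ℝ} (hp : p ∈ Δ0) {n : ℕ}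
    (h : α * alphaCount p₁ n p.2 + slack α β n < (2 * (2 * p.1 - 1)) ^ (-α)) :
    n < retTime α β p₁ p := by
  have hβ0 : 0 < β := hα.trans hαβ
  have hpos : 0 < 2 * p.1 - 1 := by have := hp.1.1; linarith
  by_contra! hle
  obtain ⟨h1, h2⟩ := Nat.sInf_mem (exists_iterate_mem (p₁ := p₁) hα hαβ hβ hp₁ hp₁' hp)
  obtain ⟨m, hm⟩ : ∃ m, retTime α β p₁ p = m + 1 := ⟨retTime α β p₁ p - 1, by
    have : 1 ≤ retTime α β p₁ p := h1
    omega⟩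
  have h2' : (skewLSV α β p₁)^[m + 1] p ∈ Δ0 := hm ▸ h2
  rw [Function.iterate_succ_apply, skewLSV_of_mem hp] at h2'
  have hall : ∀ k < m, ((skewLSV α β p₁)^[k] (2 * p.1 - 1, phiMap p₁ p.2)).1 ≤ 1 / 2 :=
    fun k hk => iterate_fst_le_half_of_notMem hα.le hβ0.le hp₁ hp₁' hp fun hk' =>
      Nat.notMem_of_lt_sInf (show k + 1 < retTime α β p₁ p by omega) ⟨by omega, hk'⟩
  have h3 := (abs_le.1 (abs_rpow_neg_sub_alphaCount_le hα hαβ hβ m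
    (2 * p.1 - 1, phiMap p₁ p.2) hpos hall)).2
  have h4 : (2 * ((skewLSV α β p₁)^[m] (2 * p.1 - 1, phiMap p₁ p.2)).1) ^ (-α) ≤ 1 :=
    Real.rpow_le_one_of_one_le_of_nonpos (by linarith [h2'.1.1]) (by linarith)
  have h5 : ∑ i ∈ Finset.range m, stepError α β i ≤ ∑ i ∈ Finset.range n, stepError α β i :=
    Finset.sum_le_sum_of_subset_of_nonneg (Finset.range_mono (by omega))
      fun i _ _ => stepError_nonneg hβ0.le i
  have h6 : alphaCount p₁ m (phiMap p₁ p.2) ≤ alphaCount p₁ n p.2 := by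
    refine le_trans ?_ (alphaCount_mono (show m + 1 ≤ n by omega) p.2)
    rw [alphaCount]
    split_ifs <;> linarith
  have h7 := mul_le_mul_of_nonneg_left h5 hα.le
  have h8 := mul_le_mul_of_nonneg_left h6 hα.le
  simp only at h3
  rw [slack] at h
  linarith

lemma one_le_slack (hα : 0 ≤ α) (hβ : 0 ≤ β) (n : ℕ) : 1 ≤ slack α β n := by
  have : 0 ≤ ∑ i ∈ Finset.range n, stepError α β i :=
    Finset.sum_nonneg fun i _ => stepError_nonneg hβ i
  unfold slack
  nlinarith [mul_nonneg hα this]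

lemma volume_Δ0_lt_top : volume Δ0 < ⊤ := by
  rw [Δ0, Measure.volume_eq_prod, Measure.prod_prod, Real.volume_Ioc, Real.volume_Icc]
  exact ENNReal.mul_lt_top ENNReal.ofReal_lt_top ENNReal.ofReal_lt_top

lemma measureReal_lt_retTime_le (hα : 0 < α) (hαβ : α < β) (hβ : β ≤ 1) (hp₁ : 0 < p₁)
    (hp₁' : p₁ < 1) {n : ℕ} (hn : 1 ≤ n) {ε : ℝ} (hε : 0 ≤ ε) (hε' : ε ≤ 2)
    (hD : 0 < α * ((p₁ - ε) * n) - slack α β n) :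
    volume.real {p : ℝ × ℝ | p ∈ Δ0 ∧ n < retTime α β p₁ p} ≤
      1 / 4 * (α * ((p₁ - ε) * n) - slack α β n) ^ (-(1 / α)) +
        Real.exp (-((ε / 2) ^ 2) * n) := by
  set D := α * ((p₁ - ε) * n) - slack α β n
  set c := D ^ (-(1 / α))
  have hc : 0 < c := Real.rpow_pos_of_pos hD _
  set A : Set ℝ := {ω | alphaCount p₁ n ω ≤ (p₁ - ε) * n}
  have hsub : {p : ℝ × ℝ | p ∈ Δ0 ∧ n < retTime α β p₁ p} ⊆
      Ioc (1 / 2 : ℝ) (1 / 2 + c / 4) ×ˢ Icc (0 : ℝ) 1 ∪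
        Ioc (1 / 2 : ℝ) 1 ×ˢ (A ∩ Icc (0 : ℝ) 1) := by
    rintro p ⟨hp, hR⟩
    by_cases hA : p.2 ∈ A
    · exact Or.inr ⟨hp.1, hA, hp.2⟩
    · left
      have hA' : (p₁ - ε) * n < alphaCount p₁ n p.2 := not_le.1 hA
      have h1 := le_of_lt_retTime hα hαβ hβ hp₁ hp₁' hp hn hR
      have h2 : D ≤ (2 * (2 * p.1 - 1)) ^ (-α) :=
        le_trans (sub_le_sub_right (mul_le_mul_of_nonneg_left hA'.le hα.le) _) h1
      rw [← Real.le_rpow_inv_iff_of_neg (by have := hp.1.1; linarith) hD (by linarith)] at h2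
      have h3 : (-α)⁻¹ = -(1 / α) := by rw [inv_neg, one_div]
      rw [h3] at h2
      exact ⟨⟨hp.1.1, by linarith⟩, hp.2⟩
  have hA : volume.real (A ∩ Icc (0 : ℝ) 1) ≤ Real.exp (-((ε / 2) ^ 2) * n) := by
    rw [← measureReal_restrict_apply' measurableSet_Icc]
    exact measureReal_alphaCount_le hp₁ hp₁' hε hε' n
  have hAfin : volume (A ∩ Icc (0 : ℝ) 1) ≠ ⊤ :=
    measure_ne_top_of_subset inter_subset_right (by simp)
  refine (measureReal_mono hsub ?_).trans ((measureReal_union_le _ _).trans ?_)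
  · apply measure_union_ne_top <;> rw [Measure.volume_eq_prod, Measure.prod_prod] <;>
      apply ENNReal.mul_ne_top <;> first | exact hAfin | simp
  · rw [Measure.volume_eq_prod, measureReal_prod_prod, measureReal_prod_prod,
      Real.volume_real_Ioc_of_le (by linarith), Real.volume_real_Icc_of_le (by norm_num),
      Real.volume_real_Ioc_of_le (by norm_num)]
    have := measureReal_nonneg (μ := volume) (s := A ∩ Icc (0 : ℝ) 1)
    linarith

lemma le_measureReal_lt_retTime (hα : 0 < α) (hαβ : α < β) (hβ : β ≤ 1) (hp₁ : 0 < p₁)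
    (hp₁' : p₁ < 1) (n : ℕ) {ε : ℝ} (hε : 0 ≤ ε) (hε' : ε ≤ 2) :
    1 / 4 * (α * ((p₁ + ε) * n) + slack α β n) ^ (-(1 / α)) *
        (1 - Real.exp (-((ε / 2) ^ 2) * n)) ≤
      volume.real {p : ℝ × ℝ | p ∈ Δ0 ∧ n < retTime α β p₁ p} := by
  set D := α * ((p₁ + ε) * n) + slack α β n
  have hD1 : 1 ≤ D := by
    have h1 := one_le_slack hα.le (hα.trans hαβ).le n
    have h2 : 0 ≤ α * ((p₁ + ε) * n) := by positivity
    linarith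
  have hD : 0 < D := by linarith
  set c := D ^ (-(1 / α))
  have hc : 0 < c := Real.rpow_pos_of_pos hD _
  have hc1 : c ≤ 1 := Real.rpow_le_one_of_one_le_of_nonpos hD1 (by simp [hα.le])
  set A : Set ℝ := {ω | (p₁ + ε) * n ≤ alphaCount p₁ n ω}
  have hAm : MeasurableSet A := measurableSet_le measurable_const (measurable_alphaCount p₁ n)
  have hsub : Ioo (1 / 2 : ℝ) (1 / 2 + c / 4) ×ˢ (Aᶜ ∩ Icc (0 : ℝ) 1) ⊆
      {p : ℝ × ℝ | p ∈ Δ0 ∧ n < retTime α β p₁ p} := by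
    rintro p ⟨⟨hp1, hp2⟩, hA, hp3⟩
    have hp : p ∈ Δ0 := ⟨⟨hp1, by linarith⟩, hp3⟩
    have hA' : alphaCount p₁ n p.2 < (p₁ + ε) * n := not_le.1 hA
    refine ⟨hp, lt_retTime_of_lt hα hαβ hβ hp₁ hp₁' hp ?_⟩
    have h2 : D < (2 * (2 * p.1 - 1)) ^ (-α) := by
      rw [← Real.lt_rpow_inv_iff_of_neg (by linarith) hD (by linarith)]
      have h3 : (-α)⁻¹ = -(1 / α) := by rw [inv_neg, one_div]
      rw [h3]
      linarith
    exact lt_of_le_of_lt (add_le_add_left (mul_le_mul_of_nonneg_left hA'.le hα.le) _) h2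
  have hA : 1 - Real.exp (-((ε / 2) ^ 2) * n) ≤ volume.real (Aᶜ ∩ Icc (0 : ℝ) 1) := by
    have h1 := measureReal_le_alphaCount hp₁ hp₁' hε hε' n
    rw [← measureReal_restrict_apply' measurableSet_Icc, measureReal_compl hAm,
      measureReal_restrict_apply_univ, Real.volume_real_Icc_of_le (by norm_num)]
    linarith
  refine le_trans ?_ (measureReal_mono hsub
    (measure_ne_top_of_subset (fun p hp => hp.1) volume_Δ0_lt_top.ne))
  rw [Measure.volume_eq_prod, measureReal_prod_prod, Real.volume_real_Ioo_of_le (by linarith)]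
  have h1 := mul_le_mul_of_nonneg_left hA (show 0 ≤ c / 4 by linarith)
  linarith

end ReturnTime

section Limits

variable {α β p₁ : ℝ}

lemma tendsto_slack_div (hα : 0 < α) (hαβ : α < β) :
    Tendsto (fun n : ℕ => slack α β n / n) atTop (𝓝 0) := by
  have hβ0 : 0 < β := hα.trans hαβ
  have h1 : Tendsto (stepError α β) atTop (𝓝 0) := by
    have hy : 0 < min α (β - α) / β := div_pos (lt_min hα (by linarith)) hβ0
    refine (tendsto_rpow_neg_atTop hy).comp ?_
    exact Tendsto.const_mul_atTop (by positivity)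
      (tendsto_natCast_atTop_atTop.comp (tendsto_add_atTop_nat 1))
  have h2 := (tendsto_inv_atTop_nhds_zero_nat (𝕜 := ℝ)).const_mul (1 + α)
  have h3 := h2.add (h1.cesaro.const_mul α)
  simp only [mul_zero, add_zero] at h3
  refine h3.congr fun n => ?_
  rw [slack]; ring

/-- The width `n ^ (-1/4)` of the window around the mean frequency of `T_α`. -/
def window (n : ℕ) : ℝ := (n : ℝ) ^ (-(1 / 4) : ℝ)

lemma tendsto_window : Tendsto window atTop (𝓝 0) :=
  (tendsto_rpow_neg_atTop (by norm_num)).comp tendsto_natCast_atTop_atTop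

lemma window_nonneg (n : ℕ) : 0 ≤ window n := by unfold window; positivity

lemma window_le {n : ℕ} (hn : 1 ≤ n) : window n ≤ 1 :=
  Real.rpow_le_one_of_one_le_of_nonpos (by exact_mod_cast hn) (by norm_num)

lemma tendsto_rpow_mul_exp_window (s : ℝ) :
    Tendsto (fun n : ℕ => (n : ℝ) ^ s * Real.exp (-((window n / 2) ^ 2) * n)) atTop (𝓝 0) := by
  have h1 : Tendsto (fun n : ℕ => (n : ℝ) ^ (1 / 2 : ℝ)) atTop atTop :=
    (tendsto_rpow_atTop (by norm_num)).comp tendsto_natCast_atTop_atTop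
  refine ((tendsto_rpow_mul_exp_neg_mul_atTop_nhds_zero (2 * s) (1 / 4) (by norm_num)).comp
    h1).congr' ?_
  filter_upwards [eventually_ge_atTop 1] with n hn
  have hn' : (0 : ℝ) < n := by exact_mod_cast hn
  have h2 : window n ^ 2 * n = (n : ℝ) ^ (1 / 2 : ℝ) := by
    rw [window, ← Real.rpow_natCast, ← Real.rpow_mul hn'.le, ← Real.rpow_add_one hn'.ne']
    norm_num
  simp only [Function.comp_apply]
  rw [← Real.rpow_mul hn'.le, ← h2]
  congr 2 <;> ring

lemma tendsto_rpow_ratio (hα : 0 < α) (hp₁ : 0 < p₁) {e r : ℕ → ℝ}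
    (he : Tendsto e atTop (𝓝 0)) (hr : Tendsto (fun n => r n / n) atTop (𝓝 0)) (s : ℝ) :
    (∀ᶠ n : ℕ in atTop, 0 < α * ((p₁ + e n) * n) + r n) ∧
    Tendsto (fun n : ℕ => (α * ((p₁ + e n) * n) + r n) ^ s / ((α * p₁) ^ s * (n : ℝ) ^ s))
      atTop (𝓝 1) := by
  have hap : 0 < α * p₁ := mul_pos hα hp₁
  have h1 : Tendsto (fun n : ℕ => (α * (p₁ + e n) + r n / n) / (α * p₁)) atTop (𝓝 1) := by
    have := (((he.const_add p₁).const_mul α).add hr).div_const (α * p₁)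
    simpa [hap.ne'] using this
  have hev : ∀ᶠ n : ℕ in atTop, 0 < α * ((p₁ + e n) * n) + r n := by
    filter_upwards [h1.eventually (lt_mem_nhds zero_lt_one), eventually_ge_atTop 1] with n h hn
    have hn' : (0 : ℝ) < n := by exact_mod_cast hn
    rw [div_pos_iff_of_pos_right hap] at h
    have := mul_pos h hn'
    rw [add_mul, div_mul_cancel₀ _ hn'.ne'] at this
    linarith
  refine ⟨hev, ?_⟩
  have h2 := h1.rpow_const (p := s) (Or.inl one_ne_zero)
  rw [Real.one_rpow] at h2
  refine h2.congr' ?_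
  filter_upwards [hev, eventually_ge_atTop 1] with n h hn
  have hn' : (0 : ℝ) < n := by exact_mod_cast hn
  rw [← Real.mul_rpow hap.le hn'.le, ← Real.div_rpow h.le (by positivity)]
  congr 1
  field_simp

end Limits

/-- Theorem 1.2, tail asymptotics: for `0 < α < β < 1`,
`(m×m){R > n} ∼ (1/4)(α p₁)^{-1/α} n^{-1/α}`. -/
theorem return_time_tail_asymptotics (α β p₁ : ℝ) (hα : 0 < α) (hαβ : α < β) (hβ : β < 1)
    (hp₁ : 0 < p₁) (hp₁' : p₁ < 1) :
    Tendsto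
      (fun n : ℕ =>
        (volume {p : ℝ × ℝ | p ∈ Δ0 ∧ n < retTime α β p₁ p}).toReal /
          ((1 / 4 : ℝ) * (α * p₁) ^ (-(1 / α)) * (n : ℝ) ^ (-(1 / α))))
      atTop (𝓝 1) := by
  have hw := tendsto_window
  have hs := tendsto_slack_div hα hαβ
  obtain ⟨-, hlow⟩ := tendsto_rpow_ratio hα hp₁ hw hs (-(1 / α))
  obtain ⟨hpos, hup⟩ := tendsto_rpow_ratio (r := fun n => -slack α β n) hα hp₁
    (by simpa using hw.neg) (by simpa [neg_div] using hs.neg) (-(1 / α))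
  have hexp := tendsto_rpow_mul_exp_window 0
  have hexp' := (tendsto_rpow_mul_exp_window (1 / α)).const_mul
    ((1 / 4 * (α * p₁) ^ (-(1 / α)))⁻¹)
  have hlow' := hlow.mul (hexp.const_sub 1)
  have hup' := hup.add hexp'
  simp only [Real.rpow_zero, one_mul, sub_zero, mul_one, mul_zero, add_zero] at hlow' hup'
  have hap : 0 < (α * p₁) ^ (-(1 / α)) := Real.rpow_pos_of_pos (mul_pos hα hp₁) _
  refine tendsto_of_tendsto_of_tendsto_of_le_of_le' hlow' hup' ?_ ?_
  · filter_upwards [eventually_ge_atTop 1] with n hn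
    have hn' : (0 : ℝ) < (n : ℝ) ^ (-(1 / α)) :=
      Real.rpow_pos_of_pos (by exact_mod_cast hn) _
    rw [le_div_iff₀ (by positivity)]
    refine le_trans (le_of_eq ?_) (le_measureReal_lt_retTime hα hαβ hβ.le hp₁ hp₁' n
      (window_nonneg n) ((window_le hn).trans one_le_two))
    field_simp
  · filter_upwards [eventually_ge_atTop 1, hpos] with n hn hD
    have hn0 : (0 : ℝ) < n := by exact_mod_cast hn
    have hn' : (0 : ℝ) < (n : ℝ) ^ (-(1 / α)) := Real.rpow_pos_of_pos hn0 _
    have hinv : (n : ℝ) ^ (1 / α) = ((n : ℝ) ^ (-(1 / α)))⁻¹ := by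
      rw [← Real.rpow_neg hn0.le, neg_neg]
    rw [div_le_iff₀ (by positivity)]
    simp only [← sub_eq_add_neg] at hD ⊢
    refine (measureReal_lt_retTime_le hα hαβ hβ.le hp₁ hp₁' hn
      (window_nonneg n) ((window_le hn).trans one_le_two) hD).trans (le_of_eq ?_)
    rw [hinv]
    field_simp
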